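/- Let A be a fixed symmetric 5×5 matrix with integer entries and det(A) ≠ 0. For every ε > 0 there is a constant C (depending only on ε and A) such that for all P ≥ 1, the number of symmetric 5×5 integer matrices B = (b_ij) with |b_ij| ≤ P for all 1 ≤ i ≤ j ≤ 5, for which the resolvent polynomial Φ(z; A,B) has a rational root z ∈ ℚ, is at most C · P^{14 + 1/10 + ε}. -/

import Mathlib

open Polynomial

/-- An algebraic closure of `ℚ`. -/
noncomputable abbrev Qbar : Type := AlgebraicClosure ℚ

/-- The polynomial `det(λ A + B)` in the single variable `λ`, with coefficients in `ℚ̄`,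
for integer matrices `A`, `B`. -/
noncomputable def charPolyZ (A B : Matrix (Fin 5) (Fin 5) ℤ) : Polynomial Qbar :=
  Matrix.det (Matrix.of fun i j =>
    Polynomial.X * Polynomial.C ((A i j : Qbar)) + Polynomial.C ((B i j : Qbar)))

section NumberFieldDivisors

open NumberField Finset

variable (L : Type*) [Field L] [NumberField L]

/-- There are at most `[L : ℚ]` primes above each rational prime, hence at most
`[L : ℚ] * (T + 1)` primes of norm at most `T`. -/
lemma card_primes_absNorm_le {n T : ℕ} (hn : Module.finrank ℚ L ≤ n)
    (s : Finset (Ideal (𝓞 L)))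
    (hs : ∀ P ∈ s, P.IsPrime ∧ P ≠ ⊥ ∧ Ideal.absNorm P ≤ T) : #s ≤ n * (T + 1) := by
  classical
  rw [← card_range (T + 1)]
  refine card_le_mul_card_image_of_maps_to (f := fun P ↦ Ideal.absNorm (Ideal.under ℤ P))
    (fun P hP ↦ ?_) n fun m _ ↦ ?_
  · obtain ⟨_, h0, hT⟩ := hs P hP
    have hne : Ideal.absNorm P ≠ 0 := by rwa [Ne, Ideal.absNorm_eq_zero_iff]
    have := Nat.le_of_dvd (Nat.pos_of_ne_zero hne) (Int.absNorm_under_dvd_absNorm P)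
    exact mem_range.mpr (by omega)
  · rcases (filter (fun P ↦ Ideal.absNorm (Ideal.under ℤ P) = m) s).eq_empty_or_nonempty with
      h | ⟨Q, hQ⟩
    · simp [h]
    obtain ⟨hQs, hQm⟩ := mem_filter.mp hQ
    obtain ⟨hQp, hQ0, -⟩ := hs Q hQs
    have hm : m.Prime := by
      have : NeZero Q := ⟨hQ0⟩
      rw [← hQm]; exact Nat.absNorm_under_prime Q
    have : Fact m.Prime := ⟨hm⟩
    have hp0 : Ideal.span {(m : ℤ)} ≠ ⊥ := by simp [hm.ne_zero]
    let := Fintype.ofFinite ((Ideal.span {(m : ℤ)}).primesOver (𝓞 L))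
    have hsum := Ideal.sum_ramification_inertia_eq_finrank (S := 𝓞 L) (Ideal.span {(m : ℤ)})
    rw [RingOfIntegers.rank] at hsum
    refine le_trans ?_ (hsum.le.trans hn)
    calc #(filter (fun P ↦ Ideal.absNorm (Ideal.under ℤ P) = m) s)
        ≤ Fintype.card ((Ideal.span {(m : ℤ)}).primesOver (𝓞 L)) := by
          rw [← Set.toFinset_card]
          refine card_le_card fun P hP ↦ ?_
          obtain ⟨hPs, hPm⟩ := mem_filter.mp hP
          rw [Set.mem_toFinset, ← hPm]
          exact ⟨(hs P hPs).1, inferInstance⟩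
      _ ≤ _ := by
          rw [Fintype.card, card_eq_sum_ones]
          refine sum_le_sum fun q _ ↦ ?_
          have := q.2.1
          exact Nat.mul_pos (Ideal.ramificationIdx_pos q.1 ℤ) (Ideal.inertiaDeg_pos q.1 ℤ)

/-- The divisor bound for ideals, uniform over number fields of bounded degree. -/
lemma card_ideal_divisors_le (n : ℕ) {ε : ℝ} (hε : 0 < ε) :
    ∃ C : ℝ, 0 < C ∧ ∀ (L : Type) [Field L] [NumberField L], Module.finrank ℚ L ≤ n →
      ∀ (J : Ideal (𝓞 L)), J ≠ ⊥ → ∀ s : Finset (Ideal (𝓞 L)), (∀ I ∈ s, I ∣ J) →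
        (#s : ℝ) ≤ C * (Ideal.absNorm J : ℝ) ^ ε := by
  classical
  set x : ℝ := ε * Real.log 2 with hx
  have hx0 : 0 < x := mul_pos hε (Real.log_pos one_lt_two)
  set A : ℝ := 1 + 1 / x with hA
  have hA1 : 1 ≤ A := by simp [hA, hx0.le]
  set T : ℕ := ⌈(2 : ℝ) ^ (1 / ε)⌉₊
  refine ⟨A ^ (n * (T + 1)), by positivity, fun L _ _ hn J hJ s hs ↦ ?_⟩
  set m := UniqueFactorizationMonoid.normalizedFactors J with hm
  have hmem : ∀ P ∈ m.toFinset, P.IsPrime ∧ P ≠ ⊥ := fun P hP ↦ by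
    have hP' := UniqueFactorizationMonoid.prime_of_normalized_factor P (Multiset.mem_toFinset.mp hP)
    exact ⟨Ideal.isPrime_of_prime hP', hP'.ne_zero⟩
  have hcard : #s ≤ ∏ P ∈ m.toFinset, (m.count P + 1) := by
    rw [← Multiset.card_Iic]
    refine card_le_card_of_injOn UniqueFactorizationMonoid.normalizedFactors
      (fun I hI ↦ ?_) fun I hI I' hI' h ↦ ?_
    · have hI0 : I ≠ 0 := ne_zero_of_dvd_ne_zero hJ (hs I hI)
      simpa using! (UniqueFactorizationMonoid.dvd_iff_normalizedFactors_le_normalizedFactors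
        hI0 hJ).mp (hs I hI)
    · have hI0 : I ≠ 0 := ne_zero_of_dvd_ne_zero hJ (hs I hI)
      have hI0' : I' ≠ 0 := ne_zero_of_dvd_ne_zero hJ (hs I' hI')
      rw [← Ideal.prod_normalizedFactors_eq_self hI0, h, Ideal.prod_normalizedFactors_eq_self hI0']
  have hnorm : (Ideal.absNorm J : ℝ) ^ ε =
      ∏ P ∈ m.toFinset, ((Ideal.absNorm P : ℝ) ^ ε) ^ m.count P := by
    conv_lhs => rw [← Ideal.prod_normalizedFactors_eq_self hJ, ← hm, map_multiset_prod,
      Finset.prod_multiset_map_count]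
    push_cast
    rw [← Real.finsetProd_rpow _ _ (fun _ _ ↦ by positivity)]
    refine prod_congr rfl fun P _ ↦ ?_
    rw [← Real.rpow_natCast, ← Real.rpow_natCast, ← Real.rpow_mul (by positivity),
      ← Real.rpow_mul (by positivity), mul_comm]
  have h2 : ∀ P ∈ m.toFinset, (2 : ℝ) ≤ Ideal.absNorm P := fun P hP ↦ by
    have h1 : Ideal.absNorm P ≠ 1 := by
      rw [Ne, Ideal.absNorm_eq_one_iff]; exact (hmem P hP).1.ne_top
    have h0 : Ideal.absNorm P ≠ 0 := by
      rw [Ne, Ideal.absNorm_eq_zero_iff]; exact (hmem P hP).2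
    exact_mod_cast (by omega : 2 ≤ Ideal.absNorm P)
  have hfac : ∀ P ∈ m.toFinset, ((m.count P + 1 : ℕ) : ℝ) ≤
      (if Ideal.absNorm P ≤ T then A else 1) * ((Ideal.absNorm P : ℝ) ^ ε) ^ m.count P := by
    intro P hP
    set e := m.count P
    have hN : (2 : ℝ) ≤ Ideal.absNorm P := h2 P hP
    split_ifs with h
    · calc ((e + 1 : ℕ) : ℝ) ≤ A * (x * e + 1) := by
            have : A * (x * e + 1) = x * e + 1 + e + 1 / x := by rw [hA]; field_simp; ring
            rw [this]; push_cast
            have := hx0.le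
            nlinarith [(by positivity : 0 ≤ x * e), (by positivity : 0 ≤ 1 / x)]
        _ ≤ A * Real.exp (x * e) := by gcongr; exact Real.add_one_le_exp _
        _ = A * ((2 : ℝ) ^ ε) ^ e := by
            rw [hx, ← Real.rpow_natCast, ← Real.rpow_mul two_pos.le,
              Real.rpow_def_of_pos two_pos]; ring_nf
        _ ≤ _ := by gcongr
    · have hle : (2 : ℝ) ^ (1 / ε) ≤ Ideal.absNorm P :=
        (Nat.le_ceil _).trans (by exact_mod_cast (not_le.mp h).le)
      have : (2 : ℝ) ≤ (Ideal.absNorm P : ℝ) ^ ε := by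
        calc (2 : ℝ) = ((2 : ℝ) ^ (1 / ε)) ^ ε := by
              rw [← Real.rpow_mul two_pos.le]; field_simp; simp
          _ ≤ _ := by gcongr
      rw [one_mul]
      calc ((e + 1 : ℕ) : ℝ) ≤ (2 : ℝ) ^ e := by exact_mod_cast Nat.lt_two_pow_self
        _ ≤ _ := by gcongr
  calc (#s : ℝ) ≤ ∏ P ∈ m.toFinset, ((m.count P + 1 : ℕ) : ℝ) := by exact_mod_cast hcard
    _ ≤ ∏ P ∈ m.toFinset, ((if Ideal.absNorm P ≤ T then A else 1) *
          ((Ideal.absNorm P : ℝ) ^ ε) ^ m.count P) := prod_le_prod (fun _ _ ↦ by positivity) hfac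
    _ = A ^ #(m.toFinset.filter fun P ↦ Ideal.absNorm P ≤ T) * (Ideal.absNorm J : ℝ) ^ ε := by
        rw [prod_mul_distrib, hnorm, prod_ite, prod_const, prod_const_one, mul_one]
    _ ≤ _ := by
        gcongr
        refine card_primes_absNorm_le L hn _ fun P hP ↦ ?_
        obtain ⟨hP, hPT⟩ := mem_filter.mp hP
        exact ⟨(hmem P hP).1, (hmem P hP).2, hPT⟩

/-- The number of algebraic integers with all conjugates of absolute value at most `2` is bounded
uniformly over number fields of bounded degree. -/
lemma card_integers_conj_le_two (n : ℕ) : ∃ C : ℕ, ∀ (L : Type) [Field L] [NumberField L],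
    Module.finrank ℚ L ≤ n → ∀ s : Finset L,
      (∀ x ∈ s, IsIntegral ℤ x ∧ ∀ φ : L →+* ℂ, ‖φ x‖ ≤ 2) → #s ≤ C := by
  classical
  set M : ℤ := 2 ^ n * 2 ^ n
  have hfin : {f : ℤ[X] | f.natDegree ≤ n ∧ ∀ i, f.coeff i ∈ Set.Icc (-M) M}.Finite := by
    let π : ℤ[X] → Fin (n + 1) → ℤ := fun f i ↦ f.coeff i
    refine ((Set.Finite.pi fun _ ↦ Set.finite_Icc (-M) M).subset ?_).of_finite_image
      (f := π) ?_
    · exact Set.image_subset_iff.2 fun f hf i _ ↦ hf.2 i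
    · exact fun f hf g hg h ↦ (ext_iff_natDegree_le hf.1 hg.1).2 fun i hi ↦
        congr_fun h ⟨i, Nat.lt_succ_of_le hi⟩
  refine ⟨#hfin.toFinset * n, fun L _ _ hn s hs ↦ ?_⟩
  have hsub : s ⊆ hfin.toFinset.biUnion fun f ↦ (f.map (algebraMap ℤ L)).roots.toFinset := by
    intro x hx
    obtain ⟨hint, hφ⟩ := hs x hx
    have hmin := minpoly.isIntegrallyClosed_eq_field_fractions' ℚ hint
    rw [mem_biUnion]
    refine ⟨minpoly ℤ x, ?_, ?_⟩
    · rw [Set.Finite.mem_toFinset]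
      refine ⟨?_, fun i ↦ ?_⟩
      · rw [← (minpoly.monic hint).natDegree_map (algebraMap ℤ ℚ), ← hmin]
        exact (minpoly.natDegree_le x).trans hn
      · rw [Set.mem_Icc, ← abs_le, ← @Int.cast_le ℝ]
        have h := Embeddings.coeff_bdd_of_norm_le hφ i
        rw [hmin, coeff_map, eq_intCast, Int.norm_cast_rat, Int.norm_eq_abs] at h
        rw [Int.cast_abs]
        refine h.trans ?_
        rw [max_eq_left one_le_two]
        push_cast [M]
        gcongr
        · exact one_le_two
        · exact_mod_cast (Nat.choose_le_two_pow _ _).trans (Nat.pow_le_pow_right two_pos hn)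
    · rw [Multiset.mem_toFinset, mem_roots ((minpoly.monic hint).map _).ne_zero, IsRoot.def,
        eval_map_algebraMap, minpoly.aeval]
  refine (card_le_card hsub).trans (card_biUnion_le_card_mul _ _ _ fun f hf ↦ ?_)
  refine (Multiset.toFinset_card_le _).trans ((card_roots' _).trans (natDegree_map_le.trans ?_))
  exact ((Set.Finite.mem_toFinset _).mp hf).1

/-- A nonzero algebraic integer whose conjugates are at most `X` has conjugates at least `X⁻ⁿ`. -/
lemma inv_pow_le_norm_conj {n : ℕ} {L : Type} [Field L] [NumberField L]
    (hn : Module.finrank ℚ L ≤ n) {X : ℝ} (hX : 1 ≤ X) {γ : 𝓞 L} (hγ : γ ≠ 0)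
    (h : ∀ φ : L →ₐ[ℚ] ℂ, ‖φ γ‖ ≤ X) (φ : L →ₐ[ℚ] ℂ) : (X ^ n)⁻¹ ≤ ‖φ γ‖ := by
  classical
  have h1 : (1 : ℝ) ≤ ∏ ψ : L →ₐ[ℚ] ℂ, ‖ψ γ‖ := by
    rw [← norm_prod, ← Algebra.norm_eq_prod_embeddings, ← Algebra.coe_norm_int]
    have : Algebra.norm ℤ γ ≠ 0 := Algebra.norm_ne_zero_iff.mpr hγ
    simp only [map_intCast, Complex.norm_intCast]
    exact_mod_cast Int.one_le_abs this
  rw [← mul_prod_erase univ _ (mem_univ φ)] at h1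
  have h2 : ∏ ψ ∈ univ.erase φ, ‖ψ γ‖ ≤ X ^ n := by
    refine (prod_le_prod (fun _ _ ↦ norm_nonneg _) fun ψ _ ↦ h ψ).trans ?_
    rw [prod_const]
    refine pow_le_pow_right₀ hX (card_erase_le.trans ?_)
    rwa [card_univ, AlgHom.card]
  rw [inv_le_iff_one_le_mul₀ (by positivity)]
  exact h1.trans (by gcongr)

/-- The number of divisors with bounded conjugates of an algebraic integer with bounded conjugates
is small, uniformly over number fields of bounded degree. -/
lemma card_bounded_divisors_le (n : ℕ) {ε : ℝ} (hε : 0 < ε) :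
    ∃ C : ℝ, 0 < C ∧ ∀ (L : Type) [Field L] [NumberField L], Module.finrank ℚ L ≤ n →
      ∀ X : ℝ, 1 ≤ X → ∀ a : 𝓞 L, a ≠ 0 → (∀ φ : L →ₐ[ℚ] ℂ, ‖φ a‖ ≤ X) →
        ∀ s : Finset (𝓞 L), (∀ γ ∈ s, γ ∣ a ∧ ∀ φ : L →ₐ[ℚ] ℂ, ‖φ γ‖ ≤ X) →
          (#s : ℝ) ≤ C * X ^ ε := by
  classical
  set δ : ℝ := ε / (2 * (n + 1)) with hδ
  have hδ0 : 0 < δ := by positivity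
  have hnδ : n * δ ≤ ε / 2 := by
    rw [hδ, mul_div_assoc', div_le_div_iff₀ (by positivity) two_pos]; nlinarith
  obtain ⟨C₁, hC₁, hideal⟩ := card_ideal_divisors_le n hδ0
  obtain ⟨C₀, hC₀⟩ := card_integers_conj_le_two n
  set D : ℝ := (n + 1) * (1 / (δ * Real.log 2) + 1) + 1 with hD
  have hlog2 : 0 < Real.log 2 := Real.log_pos one_lt_two
  refine ⟨(C₀ + 1) * (C₁ * D ^ n), by positivity, fun L _ _ hn X hX a ha haX s hs ↦ ?_⟩
  set M : ℕ := ⌈Real.logb 2 X⌉₊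
  have hX0 : 0 < X := by positivity
  have hs0 : ∀ γ ∈ s, γ ≠ 0 := fun γ hγ ↦ ne_zero_of_dvd_ne_zero ha (hs γ hγ).1
  have hpos : ∀ γ ∈ s, ∀ φ : L →ₐ[ℚ] ℂ, 0 < ‖φ γ‖ := fun γ hγ φ ↦ by
    have := hs0 γ hγ
    simpa using this
  let κ : 𝓞 L → (L →ₐ[ℚ] ℂ) → ℤ := fun γ φ ↦ ⌊Real.logb 2 ‖φ γ‖⌋
  let f : 𝓞 L → Ideal (𝓞 L) × ((L →ₐ[ℚ] ℂ) → ℤ) := fun γ ↦ (Ideal.span {γ}, κ γ)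
  let cells := Fintype.piFinset fun _ : L →ₐ[ℚ] ℂ ↦ Icc (-(n * M : ℕ) : ℤ) M
  let ideals := s.image fun γ ↦ Ideal.span {γ}
  have hmaps : ∀ γ ∈ s, f γ ∈ ideals ×ˢ cells := by
    intro γ hγ
    refine mem_product.mpr ⟨mem_image_of_mem _ hγ, Fintype.mem_piFinset.mpr fun φ ↦ ?_⟩
    have hle : Real.logb 2 X ≤ M := Nat.le_ceil _
    have hlow := inv_pow_le_norm_conj hn hX (hs0 γ hγ) (hs γ hγ).2 φ
    rw [mem_Icc]
    constructor
    · rw [Int.le_floor]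
      calc ((-(n * M : ℕ) : ℤ) : ℝ) ≤ -(n * Real.logb 2 X) := by push_cast; gcongr
        _ = Real.logb 2 (X ^ n)⁻¹ := by rw [Real.logb_inv, Real.logb_pow]
        _ ≤ _ := Real.logb_le_logb_of_le one_lt_two (by positivity) hlow
    · have : (⌊Real.logb 2 ‖φ γ‖⌋ : ℝ) ≤ M := (Int.floor_le _).trans
        ((Real.logb_le_logb_of_le one_lt_two (hpos γ hγ φ) ((hs γ hγ).2 φ)).trans hle)
      exact_mod_cast this
  have hfib : ∀ b ∈ ideals ×ˢ cells, #{γ ∈ s | f γ = b} ≤ C₀ := by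
    intro b _
    rcases (filter (fun γ ↦ f γ = b) s).eq_empty_or_nonempty with h | ⟨γ₀, hγ₀⟩
    · simp [h]
    obtain ⟨hγ₀s, hγ₀b⟩ := mem_filter.mp hγ₀
    have hγ₀L : (γ₀ : L) ≠ 0 := by have := hs0 γ₀ hγ₀s; simpa using this
    have hinj : Set.InjOn (fun γ : 𝓞 L ↦ (γ : L) / γ₀) (filter (fun γ ↦ f γ = b) s) := by
      intro γ _ γ' _ h
      exact RingOfIntegers.ext ((div_left_inj' hγ₀L).mp h)
    rw [← card_image_of_injOn hinj]
    refine hC₀ L hn _ fun x hx ↦ ?_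
    obtain ⟨γ, hγ, rfl⟩ := mem_image.mp hx
    obtain ⟨hγs, hγb⟩ := mem_filter.mp hγ
    have hff : f γ = f γ₀ := hγb.trans hγ₀b.symm
    obtain ⟨u, hu⟩ := Ideal.span_singleton_eq_span_singleton.mp (Prod.mk.inj hff).1.symm
    constructor
    · have : (γ : L) / γ₀ = ((u : 𝓞 L) : L) := by
        rw [← hu]; push_cast; field_simp
      rw [this]
      exact RingOfIntegers.isIntegral_coe _
    · intro φ
      have hκ := congr_fun (Prod.mk.inj hff).2 φ.toRatAlgHom
      simp only [κ, RingHom.toRatAlgHom_apply] at hκ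
      have h1 := Int.abs_sub_lt_one_of_floor_eq_floor hκ
      have hp := hpos γ hγs φ.toRatAlgHom
      have hp₀ := hpos γ₀ hγ₀s φ.toRatAlgHom
      simp only [RingHom.toRatAlgHom_apply] at hp hp₀
      rw [← Real.logb_div hp.ne' hp₀.ne'] at h1
      have h2 := (Real.logb_lt_iff_lt_rpow one_lt_two (by positivity)).mp (abs_lt.mp h1).2
      rw [map_div₀, norm_div]
      simpa using h2.le
  have hcard := card_le_mul_card_image_of_maps_to hmaps C₀ hfib
  rw [card_product] at hcard
  have hnormJ : (Ideal.absNorm (Ideal.span {a}) : ℝ) ≤ X ^ n := by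
    rw [Ideal.absNorm_span_singleton]
    have h1 : ((Algebra.norm ℤ a).natAbs : ℝ) = ∏ ψ : L →ₐ[ℚ] ℂ, ‖ψ a‖ := by
      rw [← norm_prod, ← Algebra.norm_eq_prod_embeddings, ← Algebra.coe_norm_int]
      simp
    rw [h1]
    refine (prod_le_prod (fun _ _ ↦ norm_nonneg _) fun ψ _ ↦ haX ψ).trans ?_
    rw [prod_const]
    refine pow_le_pow_right₀ hX ?_
    rwa [card_univ, AlgHom.card]
  have hideals : (#ideals : ℝ) ≤ C₁ * X ^ (ε / 2) := by
    refine (hideal L hn (Ideal.span {a}) (by simpa using ha) ideals fun I hI ↦ ?_).trans ?_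
    · obtain ⟨γ, hγ, rfl⟩ := mem_image.mp hI
      exact Ideal.dvd_span_singleton.mpr (Ideal.mem_span_singleton.mpr (hs γ hγ).1)
    · gcongr
      calc (Ideal.absNorm (Ideal.span {a}) : ℝ) ^ δ ≤ (X ^ n) ^ δ := by gcongr
        _ = X ^ (n * δ) := by rw [← Real.rpow_natCast, ← Real.rpow_mul hX0.le]
        _ ≤ X ^ (ε / 2) := Real.rpow_le_rpow_of_exponent_le hX hnδ
  have hcells : (#cells : ℝ) ≤ D ^ n * X ^ (ε / 2) := by
    have h1 : #cells ≤ (n * M + M + 1) ^ n := by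
      simp only [cells, Fintype.card_piFinset, prod_const, card_univ, Int.card_Icc]
      rw [AlgHom.card]
      have : ((M : ℤ) + 1 - -(n * M : ℕ)).toNat = n * M + M + 1 := by omega
      rw [this]
      exact Nat.pow_le_pow_right (by omega) hn
    have hXδ : 1 ≤ X ^ δ := Real.one_le_rpow hX hδ0.le
    have h2 : ((n * M + M + 1 : ℕ) : ℝ) ≤ D * X ^ δ := by
      have hlog : 0 ≤ Real.logb 2 X := Real.logb_nonneg one_lt_two hX
      have hM1 : (M : ℝ) ≤ Real.logb 2 X + 1 := (Nat.ceil_lt_add_one hlog).le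
      have hlogb : Real.logb 2 X ≤ 1 / (δ * Real.log 2) * X ^ δ := by
        rw [Real.logb, div_le_iff₀ hlog2]
        refine (Real.log_le_rpow_div hX0.le hδ0).trans (le_of_eq ?_)
        field_simp
      have hM2 : (M : ℝ) ≤ (1 / (δ * Real.log 2) + 1) * X ^ δ := by linarith
      push_cast
      calc (n : ℝ) * M + M + 1 = (n + 1) * M + 1 := by ring
        _ ≤ (n + 1) * ((1 / (δ * Real.log 2) + 1) * X ^ δ) + X ^ δ := by gcongr
        _ = D * X ^ δ := by rw [hD]; ring
    calc (#cells : ℝ) ≤ ((n * M + M + 1 : ℕ) : ℝ) ^ n := by exact_mod_cast h1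
      _ ≤ (D * X ^ δ) ^ n := by gcongr
      _ = D ^ n * X ^ (n * δ) := by
          rw [mul_pow, ← Real.rpow_natCast (X ^ δ), ← Real.rpow_mul hX0.le, mul_comm δ]
      _ ≤ _ := by gcongr
  calc (#s : ℝ) ≤ C₀ * (#ideals * #cells) := by exact_mod_cast hcard
    _ ≤ (C₀ + 1) * ((C₁ * X ^ (ε / 2)) * (D ^ n * X ^ (ε / 2))) := by gcongr; linarith
    _ = (C₀ + 1) * (C₁ * D ^ n) * (X ^ (ε / 2) * X ^ (ε / 2)) := by ring
    _ = _ := by rw [← Real.rpow_add hX0, add_halves]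

end NumberFieldDivisors

section PolynomialDivisors

open NumberField Finset IntermediateField

/-- The number of values at a root of a monic polynomial `K` of bounded degree, taken by divisors of
a given element of `ℤ[X]` modulo `K`, is small. -/
lemma card_divisor_values_le (n : ℕ) {ε : ℝ} (hε : 0 < ε) :
    ∃ C : ℝ, 0 < C ∧ ∀ X : ℝ, 1 ≤ X → ∀ K : ℤ[X], K.Monic → K.natDegree ≤ n →
      ∀ μ : ℂ, aeval μ K = 0 → ∀ a : ℤ[X], aeval μ a ≠ 0 →
        (∀ ν : ℂ, aeval ν K = 0 → ‖aeval ν a‖ ≤ X) → ∀ G : Finset ℤ[X],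
          (∀ g ∈ G, (∃ h, K ∣ g * h - a) ∧ ∀ ν : ℂ, aeval ν K = 0 → ‖aeval ν g‖ ≤ X) →
            (#(G.image (aeval μ : ℤ[X] →ₐ[ℤ] ℂ)) : ℝ) ≤ C * X ^ ε := by
  classical
  obtain ⟨C, hC, hdiv⟩ := card_bounded_divisors_le n hε
  refine ⟨C, hC, fun X hX K hK hKn μ hμ a ha haX G hG ↦ ?_⟩
  have hμℤ : IsIntegral ℤ μ := ⟨K, hK, by rwa [← aeval_def]⟩
  have hμℚ : IsIntegral ℚ μ := hμℤ.tower_top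
  have : FiniteDimensional ℚ ℚ⟮μ⟯ := adjoin.finiteDimensional hμℚ
  have : NumberField ℚ⟮μ⟯ := ⟨⟩
  have hrank : Module.finrank ℚ ℚ⟮μ⟯ ≤ n := by
    rw [adjoin.finrank hμℚ]
    refine (natDegree_le_of_dvd (minpoly.dvd ℚ μ (p := K.map (algebraMap ℤ ℚ)) ?_)
      (hK.map _).ne_zero).trans ?_
    · rwa [aeval_map_algebraMap]
    · rwa [hK.natDegree_map]
  have hgen : IsIntegral ℤ (AdjoinSimple.gen ℚ μ) := by
    rw [← isIntegral_algebraMap_iff (algebraMap ℚ⟮μ⟯ ℂ).injective]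
    simpa using hμℤ
  let θ : 𝓞 ℚ⟮μ⟯ := ⟨AdjoinSimple.gen ℚ μ, hgen⟩
  have hφ (φ : ℚ⟮μ⟯ →ₐ[ℚ] ℂ) (p : ℤ[X]) :
      φ (aeval θ p : 𝓞 ℚ⟮μ⟯) = aeval (φ (AdjoinSimple.gen ℚ μ)) p :=
    (aeval_algHom_apply ((φ : ℚ⟮μ⟯ →+* ℂ).comp (algebraMap (𝓞 ℚ⟮μ⟯) ℚ⟮μ⟯)).toIntAlgHom θ p).symm
  have hval (p : ℤ[X]) : algebraMap ℚ⟮μ⟯ ℂ (aeval θ p : 𝓞 ℚ⟮μ⟯) = aeval μ p :=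
    hφ (IsScalarTower.toAlgHom ℚ ℚ⟮μ⟯ ℂ) p
  have hθ : aeval θ K = 0 := by
    refine RingOfIntegers.ext ((algebraMap ℚ⟮μ⟯ ℂ).injective ?_)
    rw [hval, hμ]; simp
  have hroot (φ : ℚ⟮μ⟯ →ₐ[ℚ] ℂ) : aeval (φ (AdjoinSimple.gen ℚ μ)) K = 0 := by
    rw [← hφ, hθ]; simp
  have hcard := hdiv ℚ⟮μ⟯ hrank X hX (aeval θ a) (fun h ↦ ha (by rw [← hval, h]; simp))
    (fun φ ↦ by rw [hφ]; exact haX _ (hroot φ)) (G.image (aeval θ)) fun γ hγ ↦ by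
      obtain ⟨g, hg, rfl⟩ := mem_image.mp hγ
      obtain ⟨⟨h, q, hq⟩, hgX⟩ := hG g hg
      refine ⟨⟨aeval θ h, ?_⟩, fun φ ↦ by rw [hφ]; exact hgX _ (hroot φ)⟩
      have := congrArg (aeval θ) hq
      rw [map_sub, map_mul, map_mul, hθ, zero_mul, sub_eq_zero] at this
      exact this.symm
  refine le_trans ?_ hcard
  have : G.image (aeval μ : ℤ[X] →ₐ[ℤ] ℂ) =
      (G.image (aeval θ)).image fun γ : 𝓞 ℚ⟮μ⟯ ↦ algebraMap ℚ⟮μ⟯ ℂ γ := by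
    rw [image_image]
    exact image_congr fun g _ ↦ (hval g).symm
  rw [this]
  exact_mod_cast card_image_le

/-- A complex monic polynomial with roots at most `X` is bounded at points of size at most `X`. -/
lemma norm_eval_le_of_roots_le {X : ℝ} {p : ℂ[X]} (hp : p.Monic)
    (hroots : ∀ r : ℂ, p.IsRoot r → ‖r‖ ≤ X) {ν : ℂ} (hν : ‖ν‖ ≤ X) :
    ‖p.eval ν‖ ≤ (2 * X) ^ p.natDegree := by
  rw [(IsAlgClosed.splits p).eval_eq_prod_roots_of_monic hp,
    (IsAlgClosed.splits p).natDegree_eq_card_roots]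
  have key : ∀ m : Multiset ℂ, (∀ r ∈ m, ‖r‖ ≤ X) →
      ‖(m.map fun r ↦ ν - r).prod‖ ≤ (2 * X) ^ m.card := by
    intro m
    induction m using Multiset.induction with
    | empty => simp
    | cons r m ih =>
      intro h
      rw [Multiset.map_cons, Multiset.prod_cons, norm_mul, Multiset.card_cons, pow_succ', two_mul]
      have hr := h r (Multiset.mem_cons_self r m)
      have h0 : 0 ≤ X := (norm_nonneg ν).trans hν
      have := ih fun s hs ↦ h s (Multiset.mem_cons_of_mem hs)
      rw [two_mul] at this
      gcongr
      exact (norm_sub_le _ _).trans (add_le_add hν hr)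
  exact key _ fun r hr ↦ hroots r (isRoot_of_mem_roots hr)

/-- A complex polynomial of degree at least two without multiple roots has two distinct roots. -/
lemma exists_two_roots {p : ℂ[X]} (hp : 2 ≤ p.natDegree)
    (hder : ∀ r, p.eval r = 0 → p.derivative.eval r ≠ 0) :
    ∃ r s : ℂ, r ≠ s ∧ p.eval r = 0 ∧ p.eval s = 0 := by
  obtain ⟨r, hr⟩ := IsAlgClosed.exists_root p (natDegree_pos_iff_degree_pos.mp (by omega)).ne'
  obtain ⟨q, hq⟩ := dvd_iff_isRoot.mpr hr
  have hq0 : q ≠ 0 := by rintro rfl; simp [hq] at hp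
  have hqdeg : 0 < q.natDegree := by
    rw [hq, natDegree_mul (X_sub_C_ne_zero r) hq0, natDegree_X_sub_C] at hp
    omega
  obtain ⟨s, hs⟩ := IsAlgClosed.exists_root q (natDegree_pos_iff_degree_pos.mp hqdeg).ne'
  refine ⟨r, s, ?_, hr, by simp [hq, hs.eq_zero]⟩
  rintro rfl
  refine hder r hr ?_
  simp [hq, derivative_mul, hs.eq_zero]

/-- In a pencil `F₀ + t c K` of quintics, few members have a factor of degree at most two. -/
lemma card_reducible_pencil_le {ε : ℝ} (hε : 0 < ε) :
    ∃ C : ℝ, 0 < C ∧ ∀ X : ℝ, 1 ≤ X → ∀ K F₀ : ℤ[X], K.Monic → K.natDegree = 4 →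
      F₀.Monic → F₀.natDegree = 5 →
      (∀ μ : ℂ, aeval μ K = 0 → ‖μ‖ ≤ X ∧ aeval μ (derivative K) ≠ 0 ∧ aeval μ F₀ ≠ 0) →
      (∀ μ : ℂ, aeval μ F₀ = 0 → ‖μ‖ ≤ X) → ∀ c : ℤ, c ≠ 0 → ∀ T : Finset ℤ,
      (∀ t ∈ T, (∀ r : ℂ, aeval r (F₀ + Polynomial.C (t * c) * K) = 0 → ‖r‖ ≤ X) ∧
        ∃ g h : ℤ[X], g.Monic ∧ g.natDegree ∈ Ioc 0 2 ∧
          F₀ + Polynomial.C (t * c) * K = g * h) → (#T : ℝ) ≤ C * X ^ ε := by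
  classical
  obtain ⟨C₁, hC₁, hval⟩ := card_divisor_values_le 4 (ε := ε / 10) (by positivity)
  refine ⟨2 * C₁ ^ 2 * 2 ^ ε, by positivity,
    fun X hX K F₀ hK hK4 hF hF5 hμK hμF c hc T hT ↦ ?_⟩
  have haev (p : ℤ[X]) (r : ℂ) : (p.map (algebraMap ℤ ℂ)).eval r = aeval r p :=
    eval_map_algebraMap p r
  have hX1 : 1 ≤ 2 * X := by linarith
  have hbound (p : ℤ[X]) (hp : p.Monic) (hp5 : p.natDegree ≤ 5)
      (hpX : ∀ r : ℂ, aeval r p = 0 → ‖r‖ ≤ X) (ν : ℂ) (hν : ‖ν‖ ≤ X) :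
      ‖aeval ν p‖ ≤ (2 * X) ^ 5 := by
    rw [← haev]
    refine (norm_eval_le_of_roots_le (hp.map _) (fun r hr ↦ hpX r ?_) hν).trans ?_
    · rw [← haev]; exact hr
    · rw [hp.natDegree_map]; exact pow_le_pow_right₀ hX1 hp5
  obtain ⟨μ₁, μ₂, hne, hμ₁, hμ₂⟩ : ∃ r s : ℂ, r ≠ s ∧ aeval r K = 0 ∧ aeval s K = 0 := by
    simp_rw [← haev]
    refine exists_two_roots (by rw [hK.natDegree_map]; omega) fun r hr ↦ ?_
    rw [derivative_map, haev]
    rw [haev] at hr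
    exact (hμK r hr).2.1
  choose! hTX g h hg hdeg hgh using hT
  have hG : ∀ p ∈ T.image g, (∃ q, K ∣ p * q - F₀) ∧
      ∀ ν : ℂ, aeval ν K = 0 → ‖aeval ν p‖ ≤ (2 * X) ^ 5 := by
    intro p hp
    obtain ⟨t, ht, rfl⟩ := mem_image.mp hp
    refine ⟨⟨h t, Polynomial.C (t * c), ?_⟩, fun ν hν ↦ ?_⟩
    · rw [← hgh t ht]; ring
    · refine hbound _ (hg t ht) (by have := mem_Ioc.mp (hdeg t ht); omega)
        (fun r hr ↦ hTX t ht r ?_) ν (hμK ν hν).1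
      rw [hgh t ht, map_mul, hr, zero_mul]
  have hvals (μ : ℂ) (hμ : aeval μ K = 0) :
      (#((T.image g).image (aeval μ : ℤ[X] →ₐ[ℤ] ℂ)) : ℝ) ≤ C₁ * ((2 * X) ^ 5) ^ (ε / 10) :=
    hval _ (one_le_pow₀ hX1) K hK hK4.le μ hμ F₀ (hμK μ hμ).2.2
      (fun ν hν ↦ hbound F₀ hF hF5.le hμF ν (hμK ν hν).1) _ hG
  have hcard : #T ≤ #(Ioc 0 2 ×ˢ ((T.image g).image (aeval μ₁ : ℤ[X] →ₐ[ℤ] ℂ) ×ˢ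
      (T.image g).image (aeval μ₂ : ℤ[X] →ₐ[ℤ] ℂ))) := by
    refine card_le_card_of_injOn
      (fun t ↦ ((g t).natDegree, aeval μ₁ (g t), aeval μ₂ (g t))) (fun t ht ↦ ?_) ?_
    · rw [mem_coe, mem_product, mem_product]
      exact ⟨hdeg t ht, mem_image_of_mem _ (mem_image_of_mem _ ht),
        mem_image_of_mem _ (mem_image_of_mem _ ht)⟩
    · intro t ht t' ht' heq
      simp only [Prod.mk.injEq] at heq
      obtain ⟨hd, h₁, h₂⟩ := heq
      obtain ⟨hpos, hle⟩ := mem_Ioc.mp (hdeg t ht)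
      have hgg : (g t).map (algebraMap ℤ ℂ) = (g t').map (algebraMap ℤ ℂ) := by
        refine eq_of_degree_sub_lt_of_eval_finset_eq {μ₁, μ₂} ?_ fun x hx ↦ ?_
        · have hm := (hg t ht).map (algebraMap ℤ ℂ)
          have hm' := (hg t' ht').map (algebraMap ℤ ℂ)
          refine (degree_sub_lt_left ?_ hm.ne_zero ?_).trans_le ?_
          · rw [degree_eq_natDegree hm.ne_zero, degree_eq_natDegree hm'.ne_zero,
              (hg t ht).natDegree_map, (hg t' ht').natDegree_map, hd]
          · rw [hm.leadingCoeff, hm'.leadingCoeff]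
          · rw [degree_eq_natDegree hm.ne_zero, (hg t ht).natDegree_map, card_pair hne]
            exact_mod_cast hle
        · rw [haev, haev]
          rcases mem_insert.mp hx with rfl | hx
          · exact h₁
          · rwa [mem_singleton.mp hx]
      by_contra hne'
      obtain ⟨r, hr⟩ := IsAlgClosed.exists_root ((g t).map (algebraMap ℤ ℂ))
        (natDegree_pos_iff_degree_pos.mp (by rwa [(hg t ht).natDegree_map])).ne'
      have hr' : aeval r (g t') = 0 := by rw [← haev, ← hgg]; exact hr
      replace hr : aeval r (g t) = 0 := by rw [← haev]; exact hr
      have e₁ : aeval r (F₀ + Polynomial.C (t * c) * K) = 0 := by rw [hgh t ht]; simp [hr]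
      have e₂ : aeval r (F₀ + Polynomial.C (t' * c) * K) = 0 := by rw [hgh t' ht']; simp [hr']
      simp only [map_add, map_mul, eq_intCast, map_intCast] at e₁ e₂
      have hKr : aeval r K = 0 := by
        have h3 : ((t : ℂ) - t') * c * aeval r K = 0 := by linear_combination e₁ - e₂
        have h4 : (t : ℂ) - t' ≠ 0 := sub_ne_zero.mpr (by exact_mod_cast hne')
        have h5 : (c : ℂ) ≠ 0 := by exact_mod_cast hc
        simpa [h4, h5] using h3
      rw [hKr, mul_zero, add_zero] at e₁
      exact (hμK r hKr).2.2 e₁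
  rw [card_product, card_product, Nat.card_Ioc] at hcard
  have hpow : ((2 * X) ^ 5) ^ (ε / 10) * ((2 * X) ^ 5) ^ (ε / 10) = 2 ^ ε * X ^ ε := by
    rw [← Real.rpow_add (by positivity), ← Real.rpow_natCast, ← Real.rpow_mul (by positivity),
      ← Real.mul_rpow (by positivity) (by positivity)]
    congr 1
    push_cast; ring
  calc (#T : ℝ) ≤ 2 * (#((T.image g).image (aeval μ₁ : ℤ[X] →ₐ[ℤ] ℂ)) *
        #((T.image g).image (aeval μ₂ : ℤ[X] →ₐ[ℤ] ℂ))) := by exact_mod_cast hcard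
    _ ≤ 2 * ((C₁ * ((2 * X) ^ 5) ^ (ε / 10)) * (C₁ * ((2 * X) ^ 5) ^ (ε / 10))) := by
        gcongr
        · exact hvals μ₁ hμ₁
        · exact hvals μ₂ hμ₂
    _ = 2 * C₁ ^ 2 * (((2 * X) ^ 5) ^ (ε / 10) * ((2 * X) ^ 5) ^ (ε / 10)) := by ring
    _ = _ := by rw [hpow]; ring

end PolynomialDivisors

section SymmetricPencil

open Finset Matrix

lemma det_add_single_last {R : Type*} [CommRing R] {n : ℕ}
    (M : Matrix (Fin (n + 1)) (Fin (n + 1)) R) (t : R) :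
    (M + Matrix.single (Fin.last n) (Fin.last n) t).det =
      M.det + t * (M.submatrix Fin.castSucc Fin.castSucc).det := by
  rw [det_succ_row _ (Fin.last n), det_succ_row M (Fin.last n), Fin.sum_univ_castSucc,
    Fin.sum_univ_castSucc (n := n)]
  have hsub (j : Fin (n + 1)) :
      (M + Matrix.single (Fin.last n) (Fin.last n) t).submatrix (Fin.last n).succAbove j.succAbove =
        M.submatrix (Fin.last n).succAbove j.succAbove := by
    ext a b
    simp [(Fin.castSucc_lt_last a).ne']
  simp only [hsub]
  have hlast (x : Fin n) : Matrix.single (Fin.last n) (Fin.last n) t (Fin.last n) x.castSucc = 0 :=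
    Matrix.single_apply_of_ne _ _ _ _ _ fun h ↦ (Fin.castSucc_lt_last x).ne h.2.symm
  simp [hlast]
  ring

/-- A complex root of the characteristic polynomial is bounded by the size of the matrix times the
size of its entries. -/
lemma norm_le_of_isRoot_charpoly {n : ℕ} {M : Matrix (Fin n) (Fin n) ℂ} {Y : ℝ}
    (hM : ∀ i j, ‖M i j‖ ≤ Y) {r : ℂ} (hr : M.charpoly.IsRoot r) : ‖r‖ ≤ n * Y := by
  rw [← charpoly_toLin', ← Module.End.hasEigenvalue_iff_isRoot_charpoly] at hr
  obtain ⟨k, hk⟩ := eigenvalue_mem_ball hr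
  rw [mem_closedBall_iff_norm] at hk
  calc ‖r‖ = ‖(r - M k k) + M k k‖ := by simp
    _ ≤ ‖r - M k k‖ + ‖M k k‖ := norm_add_le _ _
    _ ≤ ∑ j ∈ univ.erase k, ‖M k j‖ + ‖M k k‖ := by gcongr
    _ = ∑ j, ‖M k j‖ := sum_erase_add _ _ (mem_univ k)
    _ ≤ ∑ j : Fin n, Y := sum_le_sum fun j _ ↦ hM k j
    _ = _ := by simp

lemma det_aeval_eq_zero {K : Type*} [CommRing K] {n : ℕ} {M : Matrix (Fin n) (Fin n) K} {g : K[X]}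
    {μ : K} (hμ : M.charpoly.eval μ = 0) (hg : g.eval μ = 0) : (aeval M g).det = 0 := by
  obtain ⟨q, rfl⟩ := dvd_iff_isRoot.mpr hg
  have : (M - Matrix.scalar (Fin n) μ).det = 0 := by
    rw [← neg_sub, det_neg, ← eval_charpoly, hμ, mul_zero]
  rw [map_mul, det_mul, map_sub, aeval_X, aeval_C]
  rw [scalar_apply] at this
  rw [algebraMap_eq_diagonal, Pi.algebraMap_def, Algebra.algebraMap_self_apply, this, zero_mul]

variable {R S : Type*} [CommRing R] [CommRing S]

/-- The matrix `-diag(c) B`, where `B` is the symmetric matrix with entries `p`. -/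
def scaledMatrix (c : Fin 5 → ℤ) (p : Sym2 (Fin 5) → R) : Matrix (Fin 5) (Fin 5) R :=
  of fun i j ↦ -(c i * p s(i, j))

/-- The position of the last diagonal entry of a symmetric matrix. -/
abbrev corner : Sym2 (Fin 5) := s(4, 4)

/-- Replace the last diagonal entry of a symmetric matrix by `0`. -/
def dropCorner (p : Sym2 (Fin 5) → R) : Sym2 (Fin 5) → R :=
  Function.update p corner 0

@[simp]
lemma dropCorner_corner (p : Sym2 (Fin 5) → R) : dropCorner p corner = 0 :=
  Function.update_self ..

lemma dropCorner_of_ne (p : Sym2 (Fin 5) → R) {z : Sym2 (Fin 5)} (hz : z ≠ corner) :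
    dropCorner p z = p z :=
  Function.update_of_ne hz ..

lemma comp_dropCorner (f : R →+* S) (p : Sym2 (Fin 5) → R) :
    f ∘ dropCorner p = dropCorner (f ∘ p) := by
  rw [dropCorner, Function.comp_update, map_zero, dropCorner]

/-- The quintic `det(X + diag(c) B)`. -/
noncomputable def quintic (c : Fin 5 → ℤ) (p : Sym2 (Fin 5) → R) : R[X] :=
  (scaledMatrix c p).charpoly

/-- The upper left block of `-diag(c) B`. -/
def scaledMinor (c : Fin 5 → ℤ) (p : Sym2 (Fin 5) → R) : Matrix (Fin 4) (Fin 4) R :=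
  (scaledMatrix c p).submatrix Fin.castSucc Fin.castSucc

/-- The characteristic polynomial of the upper left block of `-diag(c) B`. -/
noncomputable def quartic (c : Fin 5 → ℤ) (p : Sym2 (Fin 5) → R) : R[X] :=
  (scaledMinor c p).charpoly

/-- The determinant whose non-vanishing ensures that the quartic is separable and has no common root
with the quintic. -/
noncomputable def pencilDisc (c : Fin 5 → ℤ) (p : Sym2 (Fin 5) → R) : R :=
  (aeval (scaledMinor c p)
    (derivative (quartic c p) * quintic c (dropCorner p))).det

lemma quintic_monic (c : Fin 5 → ℤ) (p : Sym2 (Fin 5) → R) : (quintic c p).Monic :=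
  charpoly_monic _

lemma quartic_monic (c : Fin 5 → ℤ) (p : Sym2 (Fin 5) → R) : (quartic c p).Monic :=
  charpoly_monic _

lemma quintic_natDegree [Nontrivial R] (c : Fin 5 → ℤ) (p : Sym2 (Fin 5) → R) :
    (quintic c p).natDegree = 5 := by
  rw [quintic, charpoly_natDegree_eq_dim, Fintype.card_fin]

lemma quartic_natDegree [Nontrivial R] (c : Fin 5 → ℤ) (p : Sym2 (Fin 5) → R) :
    (quartic c p).natDegree = 4 := by
  rw [quartic, charpoly_natDegree_eq_dim, Fintype.card_fin]

lemma scaledMatrix_map (c : Fin 5 → ℤ) (p : Sym2 (Fin 5) → R) (f : R →+* S) :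
    (scaledMatrix c p).map f = scaledMatrix c (f ∘ p) := by
  ext; simp [scaledMatrix]

lemma scaledMinor_map (c : Fin 5 → ℤ) (p : Sym2 (Fin 5) → R) (f : R →+* S) :
    (scaledMinor c p).map f = scaledMinor c (f ∘ p) := by
  rw [scaledMinor, ← submatrix_map, scaledMatrix_map, scaledMinor]

lemma quintic_map (c : Fin 5 → ℤ) (p : Sym2 (Fin 5) → R) (f : R →+* S) :
    (quintic c p).map f = quintic c (f ∘ p) := by
  rw [quintic, ← charpoly_map, scaledMatrix_map, quintic]

lemma quartic_map (c : Fin 5 → ℤ) (p : Sym2 (Fin 5) → R) (f : R →+* S) :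
    (quartic c p).map f = quartic c (f ∘ p) := by
  rw [quartic, ← charpoly_map, scaledMinor_map, quartic]

lemma pencilDisc_map (c : Fin 5 → ℤ) (p : Sym2 (Fin 5) → R) (f : R →+* S) :
    f (pencilDisc c p) = pencilDisc c (f ∘ p) := by
  rw [pencilDisc, f.map_det, map_aeval_eq_aeval_map (φ := f), Polynomial.map_mul, ← derivative_map,
    quartic_map, quintic_map, comp_dropCorner, f.mapMatrix_apply, scaledMinor_map,
    pencilDisc]
  ext r i j
  simp [Algebra.algebraMap_eq_smul_one, Matrix.one_apply, apply_ite f]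

lemma pencilDisc_eq_zero {K : Type*} [CommRing K] {c : Fin 5 → ℤ} {p : Sym2 (Fin 5) → K} {μ : K}
    (hμ : (quartic c p).eval μ = 0)
    (h : (derivative (quartic c p) * quintic c (dropCorner p)).eval μ = 0) :
    pencilDisc c p = 0 :=
  det_aeval_eq_zero hμ h

lemma scaledMinor_dropCorner (c : Fin 5 → ℤ) (p : Sym2 (Fin 5) → R) :
    scaledMinor c (dropCorner p) = scaledMinor c p := by
  ext i j
  simp only [scaledMinor, scaledMatrix, submatrix_apply, of_apply]
  rw [dropCorner_of_ne]
  rw [Ne, Sym2.eq_iff]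
  rintro (⟨h, -⟩ | ⟨h, -⟩) <;> exact (Fin.castSucc_lt_last i).ne h

lemma quartic_dropCorner (c : Fin 5 → ℤ) (p : Sym2 (Fin 5) → R) :
    quartic c (dropCorner p) = quartic c p := by
  rw [quartic, scaledMinor_dropCorner, quartic]

lemma quintic_eq_add (c : Fin 5 → ℤ) (p : Sym2 (Fin 5) → R) :
    quintic c p = quintic c (dropCorner p) +
      C (p corner * (c 4 : R)) * quartic c p := by
  have h : charmatrix (scaledMatrix c p) =
      charmatrix (scaledMatrix c (dropCorner p)) +
        Matrix.single (Fin.last 4) (Fin.last 4) (C (p corner * (c 4 : R))) := by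
    ext1 i j
    by_cases hij : i = 4 ∧ j = 4
    · obtain ⟨rfl, rfl⟩ := hij
      simp [scaledMatrix, Fin.last, mul_comm]
    · have : s(i, j) ≠ corner := by
        rw [Ne, Sym2.eq_iff]; tauto
      rw [Matrix.add_apply, Matrix.single_apply_of_ne, add_zero]
      · simp only [charmatrix_apply, scaledMatrix, of_apply, dropCorner_of_ne p this]
      · exact fun h ↦ hij ⟨h.1.symm, h.2.symm⟩
  rw [quintic, charpoly, h, det_add_single_last]
  congr 2

lemma exists_pencilDisc_ne_zero {c : Fin 5 → ℤ} (hc : ∀ i, c i ≠ 0) :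
    ∃ p : Sym2 (Fin 5) → ℚ, pencilDisc c p ≠ 0 := by
  let d : Fin 4 → ℚ := fun i ↦ (i : ℕ)
  have hd : Function.Injective d := fun i j h ↦ Fin.ext (Nat.cast_injective h)
  let q : Fin 5 → Fin 5 → ℚ := fun i j ↦
    if i = 4 ∨ j = 4 then (if i = j then 0 else 1) else if i = j then -(i : ℕ) / c i else 0
  have hq : ∀ i j, q i j = q j i := by
    intro i j
    rcases eq_or_ne i j with rfl | h
    · rfl
    · simp [q, h, h.symm, or_comm]
  let p : Sym2 (Fin 5) → ℚ := Sym2.lift ⟨q, hq⟩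
  have hp (i j) : p s(i, j) = q i j := rfl
  have hne (i : Fin 4) : i.castSucc ≠ 4 := (Fin.castSucc_lt_last i).ne
  have hminor : scaledMinor c p = diagonal d := by
    ext i j
    have := hc i.castSucc
    simp [scaledMinor, scaledMatrix, hp, q, hne, diagonal_apply, d]
    split_ifs
    · field_simp
    · rfl
  have hquartic : quartic c p = ∏ i, (X - C (d i)) := by rw [quartic, hminor, charpoly_diagonal]
  have hdrop : dropCorner p = p := by
    ext z
    by_cases hz : z = corner
    · rw [hz, dropCorner_corner]; simp [hp, q]
    · exact dropCorner_of_ne p hz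
  refine ⟨p, ?_⟩
  rw [pencilDisc, hminor, hdrop]
  have haeval (g : ℚ[X]) : aeval (diagonal d) g = diagonal fun i ↦ g.eval (d i) := by
    refine (aeval_algHom_apply (diagonalAlgHom ℚ) d g).trans (congrArg diagonal (funext fun i ↦ ?_))
    exact (aeval_algHom_apply (Pi.evalAlgHom ℚ (fun _ ↦ ℚ) i) d g).symm
  rw [haeval, det_diagonal, prod_ne_zero_iff]
  intro k _
  rw [eval_mul, mul_ne_zero_iff]
  constructor
  · rw [hquartic, ← mul_prod_erase univ _ (mem_univ k), derivative_mul]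
    simp only [derivative_X_sub_C, eval_add, eval_mul, eval_sub, eval_X, eval_C, sub_self, zero_mul,
      add_zero, one_mul, eval_prod, prod_ne_zero_iff]
    exact fun i hi ↦ sub_ne_zero.mpr fun h ↦ ne_of_mem_erase hi (hd h).symm
  · intro h0
    rw [quintic, eval_charpoly] at h0
    obtain ⟨w, hw, hw0⟩ := exists_mulVec_eq_zero_iff.mpr h0
    have hrow (i : Fin 4) : (d k - d i) * w i.castSucc + c i.castSucc * w 4 = 0 := by
      have := congrFun hw0 i.castSucc
      have hci := hc i.castSucc
      simp only [mulVec, dotProduct, Fin.sum_univ_castSucc (n := 4)] at this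
      rw [Fintype.sum_eq_single i] at this
      · simpa [scaledMatrix, hp, q, hne, hci, mul_div_cancel₀, ← sub_eq_add_neg] using this
      · intro j hj
        simp [scaledMatrix, hp, q, hne, hj.symm]
    have hlast : ∑ i : Fin 4, c 4 * w i.castSucc + d k * w 4 = 0 := by
      have := congrFun hw0 4
      simpa [mulVec, dotProduct, Fin.sum_univ_castSucc (n := 4), scaledMatrix, hp, q,
        (hne _).symm] using this
    have h4 : w 4 = 0 := by
      have := hrow k
      simpa [hc] using this
    have hi (i : Fin 4) (hik : i ≠ k) : w i.castSucc = 0 := by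
      have := hrow i
      rw [h4, mul_zero, add_zero, mul_eq_zero, sub_eq_zero] at this
      exact this.resolve_left fun h ↦ hik (hd h).symm
    rw [h4, mul_zero, add_zero, Fintype.sum_eq_single k fun i h ↦ by rw [hi i h, mul_zero]] at hlast
    refine hw (funext fun i ↦ ?_)
    induction i using Fin.lastCases with
    | last => exact h4
    | cast i =>
      rcases eq_or_ne i k with rfl | h
      · simpa [hc] using hlast
      · exact hi i h

end SymmetricPencil

section Counting

open Finset

/-- The Schwartz–Zippel bound for integral points in a box. -/
lemma card_zeros_le {σ : Type*} [Fintype σ] [DecidableEq σ] {G : MvPolynomial σ ℤ} (hG : G ≠ 0)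
    {n : ℕ} (hn : Fintype.card σ = n + 1) (S : Finset ℤ) :
    #{p ∈ Fintype.piFinset fun _ : σ ↦ S | MvPolynomial.eval p G = 0} ≤ G.totalDegree * #S ^ n := by
  rcases S.eq_empty_or_nonempty with rfl | hS
  · have : Nonempty σ := Fintype.card_pos_iff.mp (by omega)
    simp
  let e : σ ≃ Fin (n + 1) := Fintype.equivFinOfCardEq hn
  have h := MvPolynomial.schwartz_zippel_totalDegree
    (p := MvPolynomial.rename e G) (by
      rwa [Ne, map_eq_zero_iff _ (MvPolynomial.rename_injective _ e.injective)]) S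
  have hS0 : (0 : ℚ≥0) < #S := by exact_mod_cast hS.card_pos
  replace h := h.trans (div_le_div_of_nonneg_right
    (Nat.cast_le.mpr (MvPolynomial.totalDegree_rename_le e G)) hS0.le)
  rw [div_le_div_iff₀ (by positivity) hS0, pow_succ, ← mul_assoc, mul_le_mul_iff_left₀ hS0] at h
  refine le_trans (card_le_card_of_injOn (fun p ↦ p ∘ e.symm) ?_ ?_) (by exact_mod_cast h)
  · intro p hp
    simp only [coe_filter, Fintype.mem_piFinset, Set.mem_ofPred_eq] at hp ⊢
    refine ⟨fun i ↦ hp.1 _, ?_⟩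
    rw [MvPolynomial.eval_rename, Function.comp_assoc, e.symm_comp_self]
    exact hp.2
  · exact fun p _ q _ h ↦ e.symm.surjective.injective_comp_right h

lemma roots_pencil_of_disc_ne_zero {c : Fin 5 → ℤ} {p : Sym2 (Fin 5) → ℤ}
    (hp : pencilDisc c p ≠ 0) {μ : ℂ} (hμ : aeval μ (quartic c p) = 0) :
    aeval μ (derivative (quartic c p)) ≠ 0 ∧
      aeval μ (quintic c (dropCorner p)) ≠ 0 := by
  let f := Int.castRingHom ℂ
  have hf (g : ℤ[X]) : aeval μ g = (g.map f).eval μ := (eval_map_algebraMap g μ).symm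
  have h : pencilDisc c (f ∘ p) ≠ 0 := by
    rw [← pencilDisc_map]; simpa [f] using hp
  rw [← not_or, ← mul_eq_zero, ← map_mul, hf, Polynomial.map_mul, ← derivative_map,
    quartic_map]
  rw [quintic_map, comp_dropCorner]
  rw [hf, quartic_map] at hμ
  refine fun h0 ↦ h (pencilDisc_eq_zero hμ ?_)
  convert h0

lemma norm_root_le {c : Fin 5 → ℤ} {M Q : ℝ} (hM : ∀ i, (|c i| : ℝ) ≤ M)
    {p : Sym2 (Fin 5) → ℤ} (hp : ∀ z, (|p z| : ℝ) ≤ Q) {r : ℂ} :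
    (aeval r (quintic c p) = 0 → ‖r‖ ≤ 5 * (M * Q)) ∧
      (aeval r (quartic c p) = 0 → ‖r‖ ≤ 5 * (M * Q)) := by
  let f := Int.castRingHom ℂ
  have hf (g : ℤ[X]) : aeval r g = (g.map f).eval r := (eval_map_algebraMap g r).symm
  have hM0 : 0 ≤ M := (abs_nonneg _).trans (hM 0)
  have hQ0 : 0 ≤ Q := (abs_nonneg _).trans (hp corner)
  have hentry (i j) : ‖scaledMatrix c (f ∘ p) i j‖ ≤ M * Q := by
    simp only [scaledMatrix, Matrix.of_apply, norm_neg, norm_mul, Function.comp_apply, f,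
      eq_intCast, Complex.norm_intCast]
    gcongr
    · exact hM i
    · exact hp _
  rw [hf, hf, quintic_map, quartic_map]
  constructor
  · exact fun h ↦ (norm_le_of_isRoot_charpoly hentry h).trans_eq (by norm_num)
  · intro h
    refine (norm_le_of_isRoot_charpoly (fun i j ↦ hentry _ _) h).trans ?_
    gcongr
    norm_num

/-- The polynomial has a monic factor of degree one or two. -/
def HasSmallFactor (F : ℤ[X]) : Prop :=
  ∃ g h : ℤ[X], g.Monic ∧ g.natDegree ∈ Ioc 0 2 ∧ F = g * h

lemma card_degenerate_le {c : Fin 5 → ℤ} (hc : ∀ i, c i ≠ 0) : ∃ D : ℕ, ∀ S : Finset ℤ,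
    #{p ∈ Fintype.piFinset fun _ : Sym2 (Fin 5) ↦ S | pencilDisc c p = 0} ≤ D * #S ^ 14 := by
  let G : MvPolynomial (Sym2 (Fin 5)) ℤ := pencilDisc c MvPolynomial.X
  have hG : G ≠ 0 := by
    obtain ⟨p, hp⟩ := exists_pencilDisc_ne_zero hc
    intro h
    refine hp ?_
    have := pencilDisc_map c MvPolynomial.X
      (MvPolynomial.eval₂Hom (Int.castRingHom ℚ) p)
    rw [show MvPolynomial.eval₂Hom (Int.castRingHom ℚ) p ∘ MvPolynomial.X = p from
      funext fun z ↦ by simp] at this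
    rw [← this, show pencilDisc c MvPolynomial.X = 0 from h, map_zero]
  refine ⟨G.totalDegree, fun S ↦ ?_⟩
  have := card_zeros_le hG (n := 14) (by rw [Sym2.card]; rfl) S
  convert this using 5 with p
  rw [pencilDisc_map]
  congr
  ext z
  simp

lemma card_hasSmallFactor_le {c : Fin 5 → ℤ} (hc : ∀ i, c i ≠ 0) {ε : ℝ} (hε : 0 < ε) :
    ∃ C : ℝ, 0 < C ∧ ∀ Q : ℕ, 1 ≤ Q → ∀ s : Finset (Sym2 (Fin 5) → ℤ),
      (∀ p ∈ s, (∀ z, |p z| ≤ Q) ∧ HasSmallFactor (quintic c p)) →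
        (#s : ℝ) ≤ C * Q ^ (14 + ε) := by
  obtain ⟨D, hD⟩ := card_degenerate_le hc
  obtain ⟨C₁, hC₁, hpencil⟩ := card_reducible_pencil_le hε
  let M : ℝ := 1 + ∑ i, (|c i| : ℝ)
  have hM (i) : (|c i| : ℝ) ≤ M := by
    have := single_le_sum (f := fun i ↦ (|c i| : ℝ)) (fun i _ ↦ abs_nonneg _) (mem_univ i)
    simp only [M]; linarith
  have hM1 : 1 ≤ M := by
    simp only [M]; linarith [sum_nonneg fun i (_ : i ∈ univ) ↦ abs_nonneg (c i : ℝ)]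
  refine ⟨(D + C₁ * (5 * M) ^ ε) * 3 ^ 14, by positivity, fun Q hQ s hs ↦ ?_⟩
  let S := Icc (-Q : ℤ) Q
  have hS : #S = 2 * Q + 1 := by simp [S]; omega
  have hQ1 : (1 : ℝ) ≤ Q := by exact_mod_cast hQ
  have hX : 1 ≤ 5 * (M * Q) := by nlinarith
  have hbad : #{p ∈ s | pencilDisc c p = 0} ≤ D * #S ^ 14 := by
    refine (card_le_card fun p hp ↦ ?_).trans (hD S)
    obtain ⟨hp, h0⟩ := mem_filter.mp hp
    rw [mem_filter, Fintype.mem_piFinset]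
    exact ⟨fun z ↦ mem_Icc.mpr (abs_le.mp ((hs p hp).1 z)), h0⟩
  let good := {p ∈ s | pencilDisc c p ≠ 0}
  let base := Fintype.piFinset fun z : Sym2 (Fin 5) ↦ if z = corner then {0} else S
  have hbase : #base = #S ^ 14 := by
    rw [Fintype.card_piFinset, ← mul_prod_erase univ _ (mem_univ corner)]
    rw [if_pos rfl, card_singleton, one_mul, prod_congr rfl (g := fun _ ↦ #S), prod_const,
      card_erase_of_mem (mem_univ _), card_univ, Sym2.card]
    · rfl
    · intro z hz
      rw [if_neg (ne_of_mem_erase hz)]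
  have hmaps : ∀ p ∈ good, dropCorner p ∈ base := by
    intro p hp
    rw [Fintype.mem_piFinset]
    intro z
    split_ifs with h
    · simp [h]
    · rw [dropCorner_of_ne p h]
      exact mem_Icc.mpr (abs_le.mp ((hs p (mem_filter.mp hp).1).1 z))
  have hfib : ∀ q ∈ base, #{p ∈ good | dropCorner p = q} ≤
      ⌊C₁ * (5 * (M * Q)) ^ ε⌋₊ := by
    intro q _
    refine Nat.le_floor ?_
    rcases (filter (fun p ↦ dropCorner p = q) good).eq_empty_or_nonempty with
      h | ⟨p₀, hp₀⟩
    · rw [h]; simp; positivity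
    obtain ⟨hp₀, hp₀q⟩ := mem_filter.mp hp₀
    obtain ⟨hp₀s, hp₀d⟩ := mem_filter.mp hp₀
    have hbd (p) (hp : p ∈ s) (z) : (|p z| : ℝ) ≤ Q := by exact_mod_cast (hs p hp).1 z
    have hqbd (z) : (|q z| : ℝ) ≤ Q := by
      rw [← hp₀q]
      by_cases hz : z = corner
      · simp [hz]
      · rw [dropCorner_of_ne p₀ hz]
        exact hbd p₀ hp₀s z
    have hquartic (p) (hp : dropCorner p = q) : quartic c p = quartic c q := by
      rw [← hp, quartic_dropCorner]
    have hinj : Set.InjOn (fun p : Sym2 (Fin 5) → ℤ ↦ p corner)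
        (filter (fun p ↦ dropCorner p = q) good) := by
      intro p hp p' hp' h
      have h₁ := (mem_filter.mp hp).2
      have h₂ := (mem_filter.mp hp').2
      ext z
      by_cases hz : z = corner
      · rw [hz]; exact h
      · rw [← dropCorner_of_ne p hz, ← dropCorner_of_ne p' hz, h₁, h₂]
    rw [← card_image_of_injOn hinj]
    refine hpencil _ hX (quartic c q) (quintic c q) (quartic_monic c q) (quartic_natDegree c q)
      (quintic_monic c q) (quintic_natDegree c q) (fun μ hμ ↦ ⟨(norm_root_le hM hqbd).2 hμ, ?_⟩)
      (fun μ hμ ↦ (norm_root_le hM hqbd).1 hμ) (c 4) (hc 4) _ fun t ht ↦ ?_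
    · rw [← hquartic p₀ hp₀q] at hμ ⊢
      rw [← hp₀q]
      exact roots_pencil_of_disc_ne_zero hp₀d hμ
    · obtain ⟨p, hp, rfl⟩ := mem_image.mp ht
      obtain ⟨hp, hpq⟩ := mem_filter.mp hp
      have hps := (mem_filter.mp hp).1
      have := quintic_eq_add c p
      rw [hpq] at this
      rw [hquartic p hpq] at this
      rw [Int.cast_id] at this
      rw [← this]
      exact ⟨fun r hr ↦ (norm_root_le hM (hbd p hps)).1 hr, (hs p hps).2⟩
  have hgood : (#good : ℝ) ≤ C₁ * (5 * (M * Q)) ^ ε * #S ^ 14 := by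
    have := card_le_mul_card_image_of_maps_to hmaps _ hfib
    rw [hbase] at this
    calc (#good : ℝ) ≤ (⌊C₁ * (5 * (M * Q)) ^ ε⌋₊ : ℝ) * #S ^ 14 := by exact_mod_cast this
      _ ≤ _ := by gcongr; exact Nat.floor_le (by positivity)
  have hS3 : (#S : ℝ) ^ 14 ≤ 3 ^ 14 * Q ^ 14 := by
    rw [← mul_pow, hS]; push_cast; gcongr; linarith
  have hQε : 1 ≤ (Q : ℝ) ^ ε := Real.one_le_rpow hQ1 hε.le
  calc (#s : ℝ) = #{p ∈ s | pencilDisc c p = 0} + #good := by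
        exact_mod_cast (card_filter_add_card_filter_not (s := s) fun p ↦ pencilDisc c p = 0).symm
    _ ≤ D * #S ^ 14 + C₁ * (5 * (M * Q)) ^ ε * #S ^ 14 := by
        gcongr; exact_mod_cast hbad
    _ = (D + C₁ * (5 * M) ^ ε * Q ^ ε) * #S ^ 14 := by
        rw [← mul_assoc 5, Real.mul_rpow (by positivity) (by positivity)]; ring
    _ ≤ (D * Q ^ ε + C₁ * (5 * M) ^ ε * Q ^ ε) * (3 ^ 14 * Q ^ 14) := by
        gcongr
        exact le_mul_of_one_le_right (by positivity) hQε
    _ = (D + C₁ * (5 * M) ^ ε) * 3 ^ 14 * (Q ^ 14 * Q ^ ε) := by ring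
    _ = _ := by rw [Real.rpow_add (by positivity)]; norm_cast

end Counting

section RationalSum

open Finset

/-- A monic integral quintic with two roots whose sum is rational is
reducible. -/
lemma hasSmallFactor_of_add_eq_ratCast {K : Type*} [Field K] [CharZero K] {F : ℤ[X]}
    (hF : F.Monic) (hdeg : F.natDegree = 5) {r s : K} (hr : aeval r F = 0) (hs : aeval s F = 0)
    {q : ℚ} (hq : r + s = q) : HasSmallFactor F := by
  by_contra hsmall
  have hirr : Irreducible F := by
    refine (hF.irreducible_iff_natDegree' ).mpr ⟨?_, fun g h hg hh hgh hd ↦ hsmall ?_⟩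
    · rintro rfl; simp at hdeg
    · exact ⟨h, g, hh, by simpa [hdeg] using hd, by rw [← hgh, mul_comm]⟩
  rw [hF.irreducible_iff_irreducible_map_fraction_map (K := ℚ)] at hirr
  set G : ℚ[X] := F.map (algebraMap ℤ ℚ) with hG
  have hGm : G.Monic := hF.map _
  have hGdeg : G.natDegree = 5 := by rw [hG, hF.natDegree_map, hdeg]
  have haG (x : K) : aeval x G = aeval x F := aeval_map_algebraMap ..
  have hmin : G = minpoly ℚ r := minpoly.eq_of_irreducible_of_monic hirr (by rw [haG, hr]) hGm
  let H : ℚ[X] := -G.comp (C q - X)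
  have hX : (C q - X : ℚ[X]).natDegree = 1 := by
    rw [natDegree_sub_eq_right_of_natDegree_lt] <;> simp
  have hlead : (C q - X : ℚ[X]).leadingCoeff = -1 := by
    rw [leadingCoeff, hX]; simp [coeff_X]
  have hHm : H.Monic := by
    rw [Monic, leadingCoeff_neg, leadingCoeff_comp (by rw [hX]; exact one_ne_zero), hlead,
      hGm.leadingCoeff, hGdeg]
    norm_num
  have hHr : aeval r H = 0 := by
    rw [map_neg, aeval_comp, map_sub, aeval_C, aeval_X, eq_ratCast, ← hq, add_sub_cancel_left,
      haG, hs, neg_zero]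
  have hGH : G = H := by
    refine (eq_of_monic_of_dvd_of_natDegree_le hGm hHm ?_ ?_).symm
    · exact hmin ▸ minpoly.dvd ℚ r hHr
    · rw [natDegree_neg, natDegree_comp, hX, mul_one]
  have hroot : G.IsRoot (q / 2) := by
    have := congr_arg (eval (q / 2)) hGH
    simp only [H, eval_neg, eval_comp, eval_sub, eval_C, eval_X, sub_half] at this
    rw [IsRoot]; linarith
  have := degree_eq_one_of_irreducible_of_root hirr hroot
  rw [degree_eq_natDegree hGm.ne_zero, hGdeg] at this
  exact absurd this (by norm_num)

end RationalSum

section Diagonalization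

open Finset Matrix

/-- A nondegenerate symmetric integral matrix is diagonalised by an integral congruence of non-zero
determinant. -/
lemma exists_transpose_mul_mul_eq_diagonal {n : ℕ} {A : Matrix (Fin n) (Fin n) ℤ} (hA : A.IsSymm)
    (hdet : A.det ≠ 0) : ∃ (U : Matrix (Fin n) (Fin n) ℤ) (D : Fin n → ℤ), U.det ≠ 0 ∧
      (∀ i, D i ≠ 0) ∧ Uᵀ * A * U = diagonal D := by
  let f := Int.castRingHom ℚ
  have hAQ : (A.map f).IsSymm := hA.map f
  obtain ⟨v, hv⟩ := LinearMap.BilinForm.exists_orthogonal_basis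
    (LinearMap.BilinForm.isSymm_iff.mp (isSymm_toBilin'_iff_isSymm.mpr hAQ))
  let w := v.reindex (finCongr (by simp : Module.finrank ℚ (Fin n → ℚ) = n))
  have hw (i j) (hij : i ≠ j) : w i ⬝ᵥ A.map f *ᵥ w j = 0 := by
    rw [← toBilin'_apply', v.reindex_apply, v.reindex_apply]
    exact hv ((finCongr _).symm.injective.ne hij)
  obtain ⟨b, hb⟩ := IsLocalization.exist_integer_multiples_of_finite (nonZeroDivisors ℤ)
    fun k : Fin n × Fin n ↦ w k.2 k.1
  choose u hu using hb
  let U : Matrix (Fin n) (Fin n) ℤ := of fun i j ↦ u (i, j)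
  have hU : U.map f = (b : ℚ) • ((Pi.basisFun ℚ (Fin n)).toMatrix w) := by
    ext i j
    simpa [f, U, Module.Basis.toMatrix_apply] using hu (i, j)
  have hUdet : U.det ≠ 0 := by
    intro h
    have h0 : f U.det = 0 := by rw [h, map_zero]
    rw [f.map_det, f.mapMatrix_apply, hU, det_smul, ← Module.Basis.det_apply] at h0
    rcases mul_eq_zero.mp h0 with h0 | h0
    · exact nonZeroDivisors.coe_ne_zero b (by exact_mod_cast eq_zero_of_pow_eq_zero h0)
    · exact ((Pi.basisFun ℚ (Fin n)).isUnit_det w).ne_zero h0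
  have hdiag : Uᵀ * A * U = diagonal fun i ↦ (Uᵀ * A * U) i i := by
    ext i j
    rcases eq_or_ne i j with rfl | hij
    · rw [diagonal_apply_eq]
    rw [diagonal_apply_ne _ hij]
    apply f.injective_int
    have : (((Pi.basisFun ℚ (Fin n)).toMatrix w)ᵀ * A.map f *
        (Pi.basisFun ℚ (Fin n)).toMatrix w) i j = 0 := by
      rw [Matrix.mul_assoc]
      exact hw i j hij
    rw [← Matrix.map_apply (f := f), Matrix.map_mul, Matrix.map_mul, transpose_map, hU,
      transpose_smul, Matrix.smul_mul, Matrix.smul_mul, Matrix.mul_smul, Matrix.smul_apply,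
      Matrix.smul_apply, this, smul_zero, smul_zero, map_zero]
  refine ⟨U, _, hUdet, fun i h ↦ ?_, hdiag⟩
  have h0 := congr_arg det hdiag
  rw [det_diagonal, prod_eq_zero (f := fun i ↦ (Uᵀ * A * U) i i) (mem_univ i) h, det_mul, det_mul,
    det_transpose] at h0
  exact mul_ne_zero (mul_ne_zero hUdet hdet) hUdet h0

lemma transpose_mul_mul_injective {n : ℕ} {U : Matrix (Fin n) (Fin n) ℤ} (hU : U.det ≠ 0) :
    Function.Injective fun B : Matrix (Fin n) (Fin n) ℤ ↦ Uᵀ * B * U := by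
  have h {V : Matrix (Fin n) (Fin n) ℤ} (hV : V.det ≠ 0) : IsRegular V :=
    isRegular_of_isLeftRegular_det (IsRegular.of_ne_zero hV).left
  intro B B' hB
  exact (h (by rwa [det_transpose])).left ((h hU).right hB)

lemma isSymm_transpose_mul_mul {n : ℕ} (U : Matrix (Fin n) (Fin n) ℤ)
    {B : Matrix (Fin n) (Fin n) ℤ} (hB : B.IsSymm) : (Uᵀ * B * U).IsSymm := by
  rw [IsSymm, transpose_mul, transpose_mul, transpose_transpose, hB, Matrix.mul_assoc]

lemma abs_transpose_mul_mul_le {n : ℕ} (U : Matrix (Fin n) (Fin n) ℤ) :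
    ∃ W : ℝ, 1 ≤ W ∧ ∀ (B : Matrix (Fin n) (Fin n) ℤ) (P : ℝ), 0 ≤ P →
      (∀ i j, (|B i j| : ℝ) ≤ P) → ∀ i j, (|(Uᵀ * B * U) i j| : ℝ) ≤ W * P := by
  let W : ℝ := ∑ i, ∑ j, ∑ l, ∑ k, (|U k i| * |U l j| : ℝ)
  refine ⟨1 + W, le_add_of_nonneg_right (by positivity), fun B P hP hB i j ↦ ?_⟩
  calc (|(Uᵀ * B * U) i j| : ℝ) = |∑ l, ∑ k, (U k i * B k l * U l j : ℝ)| := by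
        simp [mul_apply, sum_mul]
    _ ≤ ∑ l, ∑ k, |(U k i * B k l * U l j : ℝ)| :=
        (abs_sum_le_sum_abs ..).trans (sum_le_sum fun _ _ ↦ abs_sum_le_sum_abs ..)
    _ ≤ ∑ l, ∑ k, (|U k i| * |U l j| : ℝ) * P := by
        refine sum_le_sum fun l _ ↦ sum_le_sum fun k _ ↦ ?_
        rw [abs_mul, abs_mul, mul_right_comm, Int.cast_abs, Int.cast_abs]
        gcongr
        exact hB k l
    _ = (∑ l, ∑ k, (|U k i| * |U l j| : ℝ)) * P := by simp only [sum_mul]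
    _ ≤ (1 + W) * P := by
        gcongr
        refine le_trans ?_ (le_add_of_nonneg_left zero_le_one)
        refine le_trans ?_ (single_le_sum (f := fun i ↦ ∑ j, ∑ l, ∑ k, (|U k i| * |U l j| : ℝ))
          (fun _ _ ↦ by positivity) (mem_univ i))
        exact single_le_sum (f := fun j ↦ ∑ l, ∑ k, (|U k i| * |U l j| : ℝ))
          (fun _ _ ↦ by positivity) (mem_univ j)

/-- The entries of a symmetric matrix. -/
def symmEntries (B : Matrix (Fin 5) (Fin 5) ℤ) : Sym2 (Fin 5) → ℤ :=
  fun z ↦ B z.inf z.sup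

lemma symmEntries_mk {B : Matrix (Fin 5) (Fin 5) ℤ} (hB : B.IsSymm) (i j : Fin 5) :
    symmEntries B s(i, j) = B i j := by
  rcases le_total i j with h | h
  · simp [symmEntries, h]
  · simpa [symmEntries, h] using hB.apply i j

lemma symmEntries_injOn : Set.InjOn symmEntries {B | B.IsSymm} := fun B hB B' hB' h ↦ by
  ext i j
  rw [← symmEntries_mk hB, ← symmEntries_mk hB', h]

lemma eval_charPolyZ (A B : Matrix (Fin 5) (Fin 5) ℤ) (x : Qbar) :
    (charPolyZ A B).eval x =
      (x • A.map (Int.castRingHom Qbar) + B.map (Int.castRingHom Qbar)).det := by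
  rw [charPolyZ, ← coe_evalRingHom, RingHom.map_det]
  congr
  ext i j
  simp

lemma aeval_quintic_eq_zero {A B U : Matrix (Fin 5) (Fin 5) ℤ} {D : Fin 5 → ℤ}
    (hB : B.IsSymm) (hD : Uᵀ * A * U = diagonal D) {x : Qbar} (hx : (charPolyZ A B).eval x = 0) :
    aeval ((∏ i, D i : ℤ) * x : Qbar)
      (quintic (fun i ↦ ∏ j ∈ univ.erase i, D j) (symmEntries (Uᵀ * B * U))) = 0 := by
  let f := Int.castRingHom Qbar
  rw [eval_charPolyZ] at hx
  rw [aeval_def, eval₂_eq_eval_map, show algebraMap ℤ Qbar = f from rfl, quintic_map, quintic,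
    eval_charpoly]
  have key : scalar (Fin 5) ((∏ i, D i : ℤ) * x : Qbar) -
      scaledMatrix (fun i ↦ ∏ j ∈ univ.erase i, D j) (f ∘ symmEntries (Uᵀ * B * U)) =
      diagonal (fun i ↦ f (∏ j ∈ univ.erase i, D j)) *
        ((U.map f)ᵀ * (x • A.map f + B.map f) * U.map f) := by
    rw [Matrix.mul_add, Matrix.add_mul, Matrix.mul_smul, Matrix.smul_mul, ← transpose_map,
      ← Matrix.map_mul, ← Matrix.map_mul, ← Matrix.map_mul, ← Matrix.map_mul, hD]
    ext i j
    rw [diagonal_mul]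
    simp only [scaledMatrix, Function.comp_apply, symmEntries_mk (isSymm_transpose_mul_mul U hB)]
    rcases eq_or_ne i j with rfl | hij
    · simp [f, ← mul_prod_erase univ _ (mem_univ i)]
      ring
    · simp [f, hij]
  rw [key, det_mul, det_mul, det_mul, hx]
  ring

/-- If the resolvent has a rational root, the associated quintic is reducible. -/
lemma hasSmallFactor_of_resolvent_eq_zero {A B U : Matrix (Fin 5) (Fin 5) ℤ} {D : Fin 5 → ℤ}
    (hB : B.IsSymm) (hA : A.det ≠ 0) (hD : Uᵀ * A * U = diagonal D) {α : Fin 5 → Qbar}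
    (hα : charPolyZ A B = C ((A.det : Qbar)) * ∏ i, (X + C (α i))) {z : ℚ}
    (hz : ((A.det : Qbar)) ^ 4 * ∏ i, ∏ j ∈ Ioi i, ((z : Qbar) + α i + α j) = 0) :
    HasSmallFactor (quintic (fun i ↦ ∏ j ∈ univ.erase i, D j) (symmEntries (Uᵀ * B * U))) := by
  have hroot (i) : (charPolyZ A B).eval (-α i) = 0 := by
    rw [hα, eval_mul, eval_prod, prod_eq_zero (mem_univ i) (by simp), mul_zero]
  have hdet : (A.det : Qbar) ≠ 0 := Int.cast_ne_zero.mpr hA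
  obtain ⟨i, -, hi⟩ := prod_eq_zero_iff.mp ((mul_eq_zero.mp hz).resolve_left (pow_ne_zero 4 hdet))
  obtain ⟨j, -, hj⟩ := prod_eq_zero_iff.mp hi
  refine hasSmallFactor_of_add_eq_ratCast (quintic_monic _ _) (quintic_natDegree _ _)
    (aeval_quintic_eq_zero hB hD (hroot i)) (aeval_quintic_eq_zero hB hD (hroot j))
    (q := (∏ i, D i : ℤ) * z) ?_
  push_cast
  linear_combination (-∏ i, (D i : Qbar)) * hj

end Diagonalization

/-- For a fixed symmetric integer `5×5` matrix `A` with `det A ≠ 0` and every `ε > 0`,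
the number of symmetric integer matrices `B` with entries bounded by `P` such that the
resolvent `Φ(z; A, B) = det(A)^4 ∏_{i<j} (z + αᵢ + αⱼ)`, where
`det(λA + B) = det(A) ∏ᵢ (λ + αᵢ)`, has a rational root is `≪ P^(14 + 1/10 + ε)`. -/
theorem frequency_resolvent_rational_root (A : Matrix (Fin 5) (Fin 5) ℤ) (hA : A.IsSymm)
    (hdet : A.det ≠ 0) :
    ∀ ε : ℝ, 0 < ε → ∃ C : ℝ, 0 < C ∧ ∀ P : ℝ, 1 ≤ P →
      (Nat.card {B : Matrix (Fin 5) (Fin 5) ℤ //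
          B.IsSymm ∧ (∀ i j : Fin 5, (|B i j| : ℝ) ≤ P) ∧
          ∃ α : Fin 5 → Qbar,
            charPolyZ A B =
              Polynomial.C ((A.det : Qbar)) * ∏ i : Fin 5, (Polynomial.X + Polynomial.C (α i)) ∧
            ∃ z : ℚ,
              ((A.det : Qbar)) ^ 4 *
                ∏ i : Fin 5, ∏ j ∈ Finset.Ioi i, ((z : Qbar) + α i + α j) = 0} : ℝ)
        ≤ C * P ^ ((14 : ℝ) + 1 / 10 + ε) := by
  intro ε hε
  obtain ⟨U, D, hU, hD0, hD⟩ := exists_transpose_mul_mul_eq_diagonal hA hdet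
  obtain ⟨W, hW, hbound⟩ := abs_transpose_mul_mul_le U
  obtain ⟨C, hC, hcount⟩ := card_hasSmallFactor_le
    (c := fun i ↦ ∏ j ∈ Finset.univ.erase i, D j) (fun i ↦ Finset.prod_ne_zero_iff.mpr
      fun j _ ↦ hD0 j) hε
  refine ⟨C * W ^ (14 + ε), by positivity, fun P hP ↦ ?_⟩
  set T : Set (Matrix (Fin 5) (Fin 5) ℤ) := {B | _}
  change (Nat.card T : ℝ) ≤ _
  let Φ (B : Matrix (Fin 5) (Fin 5) ℤ) := symmEntries (U.transpose * B * U)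
  have hΦ : Set.InjOn Φ T := fun B hB B' hB' h ↦
    transpose_mul_mul_injective hU (symmEntries_injOn
      (isSymm_transpose_mul_mul U hB.1) (isSymm_transpose_mul_mul U hB'.1) h)
  let Q := ⌊W * P⌋₊
  have hWP : 1 ≤ W * P := one_le_mul_of_one_le_of_one_le hW hP
  have hQ : (Q : ℝ) ≤ W * P := Nat.floor_le (by linarith)
  have hbox : ∀ p ∈ Φ '' T, ∀ z, |p z| ≤ Q := by
    rintro _ ⟨B, hB, rfl⟩ z
    rw [Int.abs_eq_natAbs, Nat.cast_le, Nat.le_floor_iff (by linarith), Nat.cast_natAbs,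
      Int.cast_abs]
    exact hbound B P (by linarith) hB.2.1 z.inf z.sup
  have hfin : (Φ '' T).Finite :=
    (Set.Finite.pi' fun _ ↦ Set.finite_Icc (-Q : ℤ) Q).subset
      fun p hp z ↦ abs_le.mp (hbox p hp z)
  have hle := hcount Q ((Nat.le_floor_iff (by linarith)).mpr (by simpa using hWP)) hfin.toFinset fun p hp ↦ by
    rw [hfin.mem_toFinset] at hp
    refine ⟨hbox p hp, ?_⟩
    obtain ⟨B, ⟨hB, -, α, hα, z, hz⟩, rfl⟩ := hp
    exact hasSmallFactor_of_resolvent_eq_zero hB hdet hD hα hz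
  rw [← Nat.card_image_of_injOn hΦ, Nat.card_coe_set_eq, Set.ncard_eq_toFinset_card _ hfin]
  calc _ ≤ C * (Q : ℝ) ^ (14 + ε) := hle
    _ ≤ C * (W * P) ^ (14 + ε) := by gcongr
    _ = C * W ^ (14 + ε) * P ^ (14 + ε) := by
      rw [Real.mul_rpow (by linarith) (by linarith), mul_assoc]
    _ ≤ C * W ^ (14 + ε) * P ^ ((14 : ℝ) + 1 / 10 + ε) := by
      gcongr
      norm_num
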